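/- arXiv:2501.10707 — 2 statements merged into one kernel-verified Lean document; each statement's English description precedes it below -/
import Mathlib

section
/- Let V : ℝ → ℝ be C^∞ with V(0)=0, V'(t)=0 if and only if t=0, V''(0)=2, and V(t) → ∞ as t → ±∞. Then the function J : (0,∞) → ℝ, J(E) = (1/π) ∫_{t₋(E)}^{t₊(E)} √(E − V(t)) dt, is continuously differentiable with J'(E) = (1/π) ∫_{t₋(E)}^{t₊(E)} 1/(2√(E − V(t))) dt, and in particular J'(E) > 0 for all E > 0. -/
open Filter Set intervalIntegral
open MeasureTheory

theorem intervalIntegrable_one_div_two_mul_sqrt (a b : ℝ) :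
    IntervalIntegrable (fun x => 1 / (2 * √x)) volume a b := by
  have h : (fun x : ℝ => 1 / (2 * √x)) = fun x => (1 / 2) * x ^ (-(1 / 2) : ℝ) := by
    funext x
    rcases le_or_gt 0 x with hx | hx
    · rw [Real.rpow_neg hx, ← Real.sqrt_eq_rpow]
      ring
    · rw [Real.sqrt_eq_zero_of_nonpos hx.le, Real.rpow_def_of_neg hx]
      have : Real.cos (-(1 / 2) * Real.pi) = 0 := by
        rw [neg_mul, Real.cos_neg, one_div_mul_eq_div, Real.cos_pi_div_two]
      simp only [this]
      simp
  rw [h]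
  exact (intervalIntegrable_rpow' (by norm_num)).const_mul _

theorem intervalIntegrable_one_div_two_mul_sqrt_sub (y a b : ℝ) :
    IntervalIntegrable (fun x => 1 / (2 * √(x - y))) volume a b := by
  simpa using (intervalIntegrable_one_div_two_mul_sqrt (a - y) (b - y)).comp_sub_right y

theorem integral_one_div_two_mul_sqrt_sub (y a b : ℝ) :
    ∫ x in a..b, 1 / (2 * √(x - y)) = √(b - y) - √(a - y) := by
  refine integral_eq_of_hasDerivAt_off_countable (fun x => √(x - y)) _
    (countable_singleton y) (by fun_prop) (fun x hx => ?_)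
    (intervalIntegrable_one_div_two_mul_sqrt_sub y a b)
  exact ((hasDerivAt_id x).sub_const y).sqrt (sub_ne_zero.2 hx.2)

section NonCritical

variable {V : ℝ → ℝ} {a b : ℝ}

theorem intervalIntegrable_one_div_two_mul_sqrt_sub_comp (hab : a ≤ b) (hV : ContDiff ℝ 1 V)
    (hinj : InjOn V (Icc a b)) (hne : ∀ t ∈ Icc a b, deriv V t ≠ 0) (E : ℝ) :
    IntervalIntegrable (fun t => 1 / (2 * √(E - V t))) volume a b := by
  have himg : IntegrableOn (fun v => 1 / (2 * √(E - v))) (V '' Icc a b) := by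
    rw [hV.continuous.continuousOn.image_Icc hab]
    have h := (intervalIntegrable_one_div_two_mul_sqrt
      (E - sInf (V '' Icc a b)) (E - sSup (V '' Icc a b))).comp_sub_left E
    simp only [sub_sub_cancel] at h
    refine (intervalIntegrable_iff_integrableOn_Icc_of_le ?_).1 h
    exact csInf_le_csSup ((nonempty_Icc.2 hab).image V)
      (isCompact_Icc.image hV.continuous).bddBelow (isCompact_Icc.image hV.continuous).bddAbove
  have hint := (integrableOn_image_iff_integrableOn_abs_deriv_smul measurableSet_Icc
    (fun t _ => ((hV.differentiable one_ne_zero) t).hasDerivAt.hasDerivWithinAt) hinj _).1 himg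
  have hcont : ContinuousOn (fun t => |deriv V t|⁻¹) (Icc a b) :=
    (hV.continuous_deriv le_rfl).abs.continuousOn.inv₀ fun t ht => abs_ne_zero.2 (hne t ht)
  rw [intervalIntegrable_iff_integrableOn_Icc_of_le hab]
  refine (hint.continuousOn_mul hcont isCompact_Icc).congr_fun (fun t ht => ?_) measurableSet_Icc
  have := abs_ne_zero.2 (hne t ht)
  simp only [smul_eq_mul]
  rw [inv_mul_cancel_left₀ this]

theorem continuous_integral_sqrt_sub_mul (hab : a ≤ b) (hV : Continuous V) {w : ℝ → ℝ}
    (hw : ContinuousOn w (Icc a b)) :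
    Continuous fun E => ∫ t in a..b, √(E - V t) * w t := by
  have hw' : Continuous (IccExtend hab ((Icc a b).domRestrict w)) :=
    (continuousOn_iff_continuous_domRestrict.1 hw).Icc_extend'
  have h : Continuous fun E => ∫ t in a..b, √(E - V t) * IccExtend hab ((Icc a b).domRestrict w) t :=
    continuous_parametric_intervalIntegral_of_continuous' (by fun_prop) a b
  convert h using 2 with E
  refine integral_congr fun t ht => ?_
  rw [uIcc_of_le hab] at ht
  simp only [IccExtend_of_mem hab _ ht, domRestrict_apply]

theorem continuous_integral_one_div_two_mul_sqrt_sub (hab : a ≤ b) (hV : ContDiff ℝ 2 V)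
    (hinj : InjOn V (Icc a b)) (hne : ∀ t ∈ Icc a b, deriv V t ≠ 0) :
    Continuous fun E => ∫ t in a..b, 1 / (2 * √(E - V t)) := by
  have hV1 : ContDiff ℝ 1 V := hV.of_le one_le_two
  have hdV : ContDiff ℝ 1 (deriv V) := hV.deriv'
  set w : ℝ → ℝ := fun t => deriv (deriv V) t / deriv V t ^ 2
  have hw : ContinuousOn w (Icc a b) :=
    (hdV.continuous_deriv le_rfl).continuousOn.div (by have := hdV.continuous; fun_prop)
      fun t ht => pow_ne_zero 2 (hne t ht)
  have hVc := hV.continuous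
  have hsw (E : ℝ) : IntervalIntegrable (fun t => √(E - V t) * w t) volume a b := by
    refine ContinuousOn.intervalIntegrable ?_
    rw [uIcc_of_le hab]
    exact ContinuousOn.mul (by fun_prop) hw
  have hf := intervalIntegrable_one_div_two_mul_sqrt_sub_comp hab hV1 hinj hne
  have key (E : ℝ) : ∫ t in a..b, 1 / (2 * √(E - V t)) =
      √(E - V a) / deriv V a - √(E - V b) / deriv V b - ∫ t in a..b, √(E - V t) * w t := by
    have h := integral_eq_of_hasDerivAt_off_countable_of_le (fun t => √(E - V t) / deriv V t)
      (fun t => -(1 / (2 * √(E - V t))) - √(E - V t) * w t) hab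
      (s := {t ∈ Icc a b | V t = E})
      (Set.Subsingleton.countable fun x hx y hy => hinj hx.1 hy.1 (hx.2.trans hy.2.symm))
      (ContinuousOn.div (by fun_prop) hdV.continuous.continuousOn hne)
      (fun t ht => by
        have hmem := Ioo_subset_Icc_self ht.1
        have hE : E - V t ≠ 0 := fun h0 => ht.2 ⟨hmem, (sub_eq_zero.1 h0).symm⟩
        have h1 := (((hV1.differentiable one_ne_zero) t).hasDerivAt.const_sub E).sqrt hE
        have h2 := h1.div ((hdV.differentiable one_ne_zero) t).hasDerivAt (hne t hmem)
        refine h2.congr_deriv ?_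
        have := hne t hmem
        simp only [w]
        generalize √(E - V t) = s
        by_cases hs : s = 0
        · simp [hs]
        · field_simp)
      ((hf E).neg.sub (hsw E))
    rw [integral_sub (by exact (hf E).neg) (hsw E), intervalIntegral.integral_neg] at h
    linarith
  have hI := continuous_integral_sqrt_sub_mul hab hVc hw
  simp only [key]
  fun_prop

end NonCritical

theorem intervalIntegrable_one_div_two_mul_sqrt_sub_of_lt {V : ℝ → ℝ} {a b E : ℝ}
    (hV : Continuous V) (h : ∀ t ∈ uIcc a b, V t < E) :
    IntervalIntegrable (fun t => 1 / (2 * √(E - V t))) volume a b :=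
  ContinuousOn.intervalIntegrable <| continuousOn_const.div (by fun_prop) fun t ht =>
    mul_ne_zero two_ne_zero (Real.sqrt_pos.2 (sub_pos.2 (h t ht))).ne'

theorem continuousOn_integral_one_div_two_mul_sqrt_sub {V : ℝ → ℝ} {a b m : ℝ}
    (hV : Continuous V) (hm : ∀ t ∈ uIcc a b, V t ≤ m) :
    ContinuousOn (fun E => ∫ t in a..b, 1 / (2 * √(E - V t))) (Ioi m) := by
  intro E₀ hE₀
  obtain ⟨c, hmc, hcE⟩ := exists_between (mem_Ioi.1 hE₀)
  have hc : Continuous fun E => ∫ t in a..b, 1 / (2 * √(max (E - V t) (c - m))) :=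
    continuous_parametric_intervalIntegral_of_continuous'
      (continuous_const.div (by fun_prop) fun p => mul_ne_zero two_ne_zero
        (Real.sqrt_pos.2 (lt_max_of_lt_right (sub_pos.2 hmc))).ne') a b
  refine (hc.continuousAt.congr ?_).continuousWithinAt
  filter_upwards [lt_mem_nhds hcE] with E hE
  refine integral_congr fun t ht => ?_
  have := hm t ht
  simp only [max_eq_left (show c - m ≤ E - V t by linarith)]

theorem strictMonoOn_Ici_of_deriv_ne_zero {g : ℝ → ℝ} (hg : Differentiable ℝ g)
    (hne : ∀ t, 0 < t → deriv g t ≠ 0) {x : ℝ} (hx : 0 < x) (h0 : g 0 < g x) :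
    StrictMonoOn g (Ici 0) := by
  rcases hasDerivWithinAt_forall_lt_or_forall_gt_of_forall_ne (convex_Ioi (0 : ℝ))
    (fun t _ => (hg t).hasDerivAt.hasDerivWithinAt) hne with h | h
  · have := strictAntiOn_of_deriv_neg (convex_Ici 0) hg.continuous.continuousOn
      (by simpa using h)
    exact absurd (this self_mem_Ici hx.le hx) h0.not_gt
  · exact strictMonoOn_of_deriv_pos (convex_Ici 0) hg.continuous.continuousOn (by simpa using h)

theorem strictAntiOn_Iic_of_deriv_ne_zero {g : ℝ → ℝ} (hg : Differentiable ℝ g)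
    (hne : ∀ t, t < 0 → deriv g t ≠ 0) {x : ℝ} (hx : x < 0) (h0 : g 0 < g x) :
    StrictAntiOn g (Iic 0) := by
  have h := strictMonoOn_Ici_of_deriv_ne_zero (g := fun t => g (-t)) (hg.comp differentiable_neg)
    (fun t ht => by
      rw [deriv_comp_neg]
      exact neg_ne_zero.2 (hne _ (neg_lt_zero.2 ht))) (neg_pos.2 hx) (by simpa using h0)
  intro s hs t ht hst
  simpa using h (mem_Ici.2 (neg_nonneg.2 ht)) (mem_Ici.2 (neg_nonneg.2 hs)) (neg_lt_neg hst)

theorem integrable_one_div_two_mul_sqrt_sub_prod {V : ℝ → ℝ} (hV : Continuous V)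
    (a b E₁ E₂ : ℝ) :
    Integrable (Function.uncurry fun E t : ℝ => 1 / (2 * √(E - V t)))
      ((volume.restrict (uIoc E₁ E₂)).prod (volume.restrict (uIoc a b))) := by
  have hmeas : Measurable (Function.uncurry fun E t : ℝ => 1 / (2 * √(E - V t))) := by
    have := hV.measurable
    unfold Function.uncurry
    fun_prop
  rw [integrable_prod_iff' hmeas.aestronglyMeasurable]
  refine ⟨.of_forall fun t => (intervalIntegrable_one_div_two_mul_sqrt_sub (V t) E₁ E₂).def', ?_⟩
  have hnorm (t : ℝ) : ∫ E in uIoc E₁ E₂, ‖1 / (2 * √(E - V t))‖ =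
      √(max E₁ E₂ - V t) - √(min E₁ E₂ - V t) := by
    rw [← integral_one_div_two_mul_sqrt_sub, integral_of_le min_le_max, uIoc]
    refine integral_congr_ae (.of_forall fun E => ?_)
    exact Real.norm_of_nonneg (by positivity)
  simp only [Function.uncurry_apply_pair, hnorm]
  exact (Continuous.intervalIntegrable (by fun_prop) a b).def'

theorem integral_integral_one_div_two_mul_sqrt_sub {V : ℝ → ℝ} (hV : Continuous V) {a b : ℝ}
    (hab : a ≤ b) (E₁ E₂ : ℝ) :
    ∫ E in E₁..E₂, ∫ t in a..b, 1 / (2 * √(E - V t)) =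
      (∫ t in a..b, √(E₂ - V t)) - ∫ t in a..b, √(E₁ - V t) := by
  have h := integrable_one_div_two_mul_sqrt_sub_prod hV a b E₁ E₂
  rw [uIoc_of_le hab] at h
  simp only [integral_of_le hab]
  rw [intervalIntegral_integral_swap h]
  simp only [integral_one_div_two_mul_sqrt_sub, ← integral_of_le hab]
  exact integral_sub (Continuous.intervalIntegrable (by fun_prop) a b)
    (Continuous.intervalIntegrable (by fun_prop) a b)

theorem integral_comp_sub_eq_of_le {V φ : ℝ → ℝ} {a b c d E : ℝ} (hφ : ∀ x ≤ 0, φ x = 0)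
    (hac : a ≤ c) (hcd : c ≤ d) (hdb : d ≤ b)
    (hl : ∀ t ∈ Icc a c, E ≤ V t) (hr : ∀ t ∈ Icc d b, E ≤ V t) :
    ∫ t in a..b, φ (E - V t) = ∫ t in c..d, φ (E - V t) := by
  rw [integral_of_le (hac.trans (hcd.trans hdb)), integral_of_le hcd]
  refine setIntegral_eq_of_subset_of_forall_sdiff_eq_zero measurableSet_Ioc
    (Ioc_subset_Ioc hac hdb) fun t ht => hφ _ (sub_nonpos.2 ?_)
  by_cases htc : t ≤ c
  · exact hl t ⟨ht.1.1.le, htc⟩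
  · exact hr t ⟨(not_le.1 fun h => ht.2 ⟨not_le.1 htc, h⟩).le, ht.1.2⟩

/-- With `V` a single well potential and `t₋(E) < 0 < t₊(E)` the
turning points (`V (t₋ E) = E = V (t₊ E)`), the function
`J(E) = (1/π) ∫_{t₋(E)}^{t₊(E)} √(E - V t) dt` is continuously differentiable on
`(0, ∞)` with `J'(E) = (1/π) ∫_{t₋(E)}^{t₊(E)} 1/(2 √(E - V t)) dt > 0`. -/
theorem stmt1 (V : ℝ → ℝ)
    (hV : ContDiff ℝ (⊤ : ℕ∞) V)
    (hV0 : V 0 = 0)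
    (hVcrit : ∀ t : ℝ, deriv V t = 0 ↔ t = 0)
    (hV'' : deriv (deriv V) 0 = 2)
    (hVtop : Tendsto V atTop atTop)
    (hVbot : Tendsto V atBot atTop)
    (tm tp : ℝ → ℝ)
    (htm : ∀ E : ℝ, 0 < E → tm E < 0 ∧ V (tm E) = E)
    (htp : ∀ E : ℝ, 0 < E → 0 < tp E ∧ V (tp E) = E)
    (J : ℝ → ℝ)
    (hJ : ∀ E : ℝ, 0 < E →
      J E = (1 / Real.pi) * ∫ t in tm E..tp E, Real.sqrt (E - V t)) :
    ContDiffOn ℝ 1 J (Ioi 0) ∧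
    ∀ E : ℝ, 0 < E →
      HasDerivAt J ((1 / Real.pi) * ∫ t in tm E..tp E, 1 / (2 * Real.sqrt (E - V t))) E ∧
      0 < (1 / Real.pi) * ∫ t in tm E..tp E, 1 / (2 * Real.sqrt (E - V t)) := by
  have hVc := hV.continuous
  have hVd : Differentiable ℝ V := hV.differentiable (by simp)
  have hV1 : ContDiff ℝ 1 V := contDiff_infty.1 hV 1
  have hV2 : ContDiff ℝ 2 V := contDiff_infty.1 hV 2
  have hmono : StrictMonoOn V (Ici 0) :=
    strictMonoOn_Ici_of_deriv_ne_zero hVd (fun t ht => (hVcrit t).not.2 ht.ne')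
      (htp 1 one_pos).1 (by simp [hV0, (htp 1 one_pos).2])
  have hanti : StrictAntiOn V (Iic 0) :=
    strictAntiOn_Iic_of_deriv_ne_zero hVd (fun t ht => (hVcrit t).not.2 ht.ne)
      (htm 1 one_pos).1 (by simp [hV0, (htm 1 one_pos).2])
  have hlt {E E' : ℝ} (hE : 0 < E) (hEE' : E < E') : tm E' < tm E ∧ tp E < tp E' := by
    have hE' := hE.trans hEE'
    refine ⟨(hanti.lt_iff_gt (htm E hE).1.le (htm E' hE').1.le).1 ?_,
      (hmono.lt_iff_lt (htp E hE).1.le (htp E' hE').1.le).1 ?_⟩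
    · rwa [(htm E hE).2, (htm E' hE').2]
    · rwa [(htp E hE).2, (htp E' hE').2]
  have hge_left {E t : ℝ} (hE : 0 < E) (ht : t ≤ tm E) : E ≤ V t :=
    (htm E hE).2.symm.le.trans
      (hanti.antitoneOn (ht.trans (htm E hE).1.le) (htm E hE).1.le ht)
  have hge_right {E t : ℝ} (hE : 0 < E) (ht : tp E ≤ t) : E ≤ V t :=
    (htp E hE).2.symm.le.trans
      (hmono.monotoneOn (htp E hE).1.le ((htp E hE).1.le.trans ht) ht)
  have hle_mid {E t : ℝ} (hE : 0 < E) (h1 : tm E ≤ t) (h2 : t ≤ tp E) : V t ≤ E := by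
    rcases le_total t 0 with ht | ht
    · exact (hanti.antitoneOn (htm E hE).1.le ht h1).trans (htm E hE).2.le
    · exact (hmono.monotoneOn ht (htp E hE).1.le h2).trans (htp E hE).2.le
  have hlt_mid {E t : ℝ} (hE : 0 < E) (h1 : tm E < t) (h2 : t < tp E) : V t < E := by
    rcases le_total t 0 with ht | ht
    · exact (hanti (htm E hE).1.le ht h1).trans_le (htm E hE).2.le
    · exact (hmono ht (htp E hE).1.le h2).trans_le (htp E hE).2.le
  set K : ℝ → ℝ := fun E => ∫ t in tm E..tp E, 1 / (2 * √(E - V t))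
  -- Near `E₀`, all the integrals may be taken over the fixed interval `[tm (E₀ + 1), tp (E₀ + 1)]`.
  have hlocal (E₀ : ℝ) (hE₀ : 0 < E₀) :
      HasDerivAt J (1 / Real.pi * K E₀) E₀ ∧ ContinuousAt K E₀ ∧ 0 < K E₀ := by
    have hm : 0 < E₀ / 2 := half_pos hE₀
    have hM : 0 < E₀ + 1 := by linarith
    set a := tm (E₀ + 1)
    set b := tp (E₀ + 1)
    set c := tm (E₀ / 2)
    set d := tp (E₀ / 2)
    have hc0 : c < 0 := (htm _ hm).1
    have hd0 : 0 < d := (htp _ hm).1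
    obtain ⟨hac, hdb⟩ : a < c ∧ d < b := hlt hm (by linarith)
    have hcd : c ≤ d := hc0.le.trans hd0.le
    have hab : a ≤ b := hac.le.trans (hcd.trans hdb.le)
    have hinjl : InjOn V (Icc a c) := hanti.injOn.mono fun t ht => ht.2.trans hc0.le
    have hinjr : InjOn V (Icc d b) := hmono.injOn.mono fun t ht => hd0.le.trans ht.1
    have hnel : ∀ t ∈ Icc a c, deriv V t ≠ 0 := fun t ht =>
      (hVcrit t).not.2 (ht.2.trans_lt hc0).ne
    have hner : ∀ t ∈ Icc d b, deriv V t ≠ 0 := fun t ht =>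
      (hVcrit t).not.2 (hd0.trans_le ht.1).ne'
    have hmid : ∀ t ∈ uIcc c d, V t ≤ E₀ / 2 := fun t ht => by
      rw [uIcc_of_le hcd] at ht
      exact hle_mid hm ht.1 ht.2
    have hil := intervalIntegrable_one_div_two_mul_sqrt_sub_comp hac.le hV1 hinjl hnel
    have hir := intervalIntegrable_one_div_two_mul_sqrt_sub_comp hdb.le hV1 hinjr hner
    have him (E : ℝ) (hE : E₀ / 2 < E) :
        IntervalIntegrable (fun t => 1 / (2 * √(E - V t))) volume c d :=
      intervalIntegrable_one_div_two_mul_sqrt_sub_of_lt hVc fun t ht => (hmid t ht).trans_lt hE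
    have hcont : ContinuousOn (fun E => ∫ t in a..b, 1 / (2 * √(E - V t))) (Ioi (E₀ / 2)) := by
      refine (((continuous_integral_one_div_two_mul_sqrt_sub hac.le hV2 hinjl hnel).continuousOn.add
        (continuousOn_integral_one_div_two_mul_sqrt_sub hVc hmid)).add
        (continuous_integral_one_div_two_mul_sqrt_sub hdb.le hV2 hinjr hner).continuousOn).congr ?_
      intro E hE
      simp only [Pi.add_apply]
      rw [integral_add_adjacent_intervals (hil E) (him E hE),
        integral_add_adjacent_intervals ((hil E).trans (him E hE)) (hir E)]
    have hcontAt : ContinuousAt (fun E => ∫ t in a..b, 1 / (2 * √(E - V t))) E₀ :=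
      hcont.continuousAt (Ioi_mem_nhds (by linarith))
    have hshrink {φ : ℝ → ℝ} (hφ : ∀ x ≤ 0, φ x = 0) {E : ℝ} (hE : E ∈ Ioo 0 (E₀ + 1)) :
        ∫ t in a..b, φ (E - V t) = ∫ t in tm E..tp E, φ (E - V t) :=
      integral_comp_sub_eq_of_le hφ (hlt hE.1 hE.2).1.le
        ((htm E hE.1).1.trans (htp E hE.1).1).le (hlt hE.1 hE.2).2.le
        (fun t ht => hge_left hE.1 ht.2) (fun t ht => hge_right hE.1 ht.1)
    have hKeq {E : ℝ} (hE : E ∈ Ioo 0 (E₀ + 1)) :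
        ∫ t in a..b, 1 / (2 * √(E - V t)) = K E :=
      hshrink (φ := fun x => 1 / (2 * √x))
        (fun x hx => by simp [Real.sqrt_eq_zero_of_nonpos hx]) hE
    have hJeq {E : ℝ} (hE : E ∈ Ioo 0 (E₀ + 1)) :
        J E = 1 / Real.pi * ∫ t in a..b, √(E - V t) := by
      rw [hJ E hE.1, hshrink (φ := Real.sqrt) (fun x => Real.sqrt_eq_zero_of_nonpos) hE]
    have hmem : E₀ ∈ Ioo 0 (E₀ + 1) := ⟨hE₀, by linarith⟩
    have hnhds : Ioo 0 (E₀ + 1) ∈ nhds E₀ := Ioo_mem_nhds hmem.1 hmem.2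
    refine ⟨?_, ?_, ?_⟩
    · have hFTC := integral_hasDerivAt_right
        (IntervalIntegrable.refl (f := fun E => ∫ t in a..b, 1 / (2 * √(E - V t))) (a := E₀))
        (hcont.stronglyMeasurableAtFilter isOpen_Ioi E₀ (by simp only [mem_Ioi]; linarith)) hcontAt
      have hder := (hFTC.const_mul (1 / Real.pi)).const_add (J E₀)
      simp only [hKeq hmem] at hder
      refine hder.congr_of_eventuallyEq ?_
      filter_upwards [hnhds] with E hE
      rw [integral_integral_one_div_two_mul_sqrt_sub hVc hab, hJeq hE, hJeq hmem]
      ring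
    · refine hcontAt.congr ?_
      filter_upwards [hnhds] with E hE using hKeq hE
    · have hint := (((hil E₀).trans (him E₀ (by linarith))).trans (hir E₀)).mono_set
        (c := tm E₀) (d := tp E₀) (by
          rw [uIcc_of_le hab, uIcc_of_le ((htm E₀ hE₀).1.trans (htp E₀ hE₀).1).le]
          exact Icc_subset_Icc (hlt hE₀ hmem.2).1.le (hlt hE₀ hmem.2).2.le)
      refine intervalIntegral_pos_of_pos_on hint (fun t ht => ?_)
        ((htm E₀ hE₀).1.trans (htp E₀ hE₀).1)
      have := Real.sqrt_pos.2 (sub_pos.2 (hlt_mid hE₀ ht.1 ht.2))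
      positivity
  have hpi : 0 < 1 / Real.pi := one_div_pos.2 Real.pi_pos
  refine ⟨?_, fun E hE => ⟨(hlocal E hE).1, mul_pos hpi (hlocal E hE).2.2⟩⟩
  rw [← zero_add (1 : WithTop ℕ∞), contDiffOn_succ_iff_deriv_of_isOpen isOpen_Ioi]
  refine ⟨fun E hE => (hlocal E hE).1.differentiableAt.differentiableWithinAt, by simp, ?_⟩
  rw [contDiffOn_zero]
  have hKc : ContinuousOn (fun E => 1 / Real.pi * K E) (Ioi 0) := fun E hE =>
    ((hlocal E hE).2.1.const_mul _).continuousWithinAt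
  exact hKc.congr fun E hE => (hlocal E hE).1.deriv
end

section
/- Let V : ℝ → ℝ be C^∞ with V(0)=0, V'(t)=0 if and only if t=0, V''(0)=2, and V(t) → ∞ as t → ±∞. Then J : (0,∞) → (0,∞), J(E) = (1/π) ∫_{t₋(E)}^{t₊(E)} √(E − V(t)) dt, is a C^∞ diffeomorphism of (0,∞) onto (0,∞): J is C^∞-smooth, J'(E) > 0 for all E > 0, and J maps (0,∞) bijectively onto (0,∞). -/
open Filter Set intervalIntegral

/-- Differentiation under the integral sign for `r ↦ ∫ θ, w θ * f (r * s θ)`. -/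
lemma hasDerivAt_integral_mul_comp_mul {w s f : ℝ → ℝ} (hw : Continuous w) (hs : Continuous s)
    (hf : ContDiff ℝ 1 f) (a b r : ℝ) :
    HasDerivAt (fun r => ∫ θ in a..b, w θ * f (r * s θ))
      (∫ θ in a..b, (w θ * s θ) * deriv f (r * s θ)) r := by
  have hf' : Continuous (deriv f) := hf.continuous_deriv le_rfl
  have hfc : Continuous f := hf.continuous
  have hcont : Continuous fun p : ℝ × ℝ => (w p.2 * s p.2) * deriv f (p.1 * s p.2) := by
    fun_prop
  obtain ⟨C, hC⟩ := ((isCompact_closedBall r 1).prod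
    (isCompact_uIcc (a := a) (b := b))).exists_bound_of_continuousOn hcont.continuousOn
  refine (intervalIntegral.hasDerivAt_integral_of_dominated_loc_of_deriv_le (bound := fun _ => C)
    (F := fun r θ => w θ * f (r * s θ))
    (F' := fun r θ => (w θ * s θ) * deriv f (r * s θ))
    (Metric.closedBall_mem_nhds r one_pos) (Eventually.of_forall fun x => ?_) ?_ ?_ ?_ ?_ ?_).2
  · exact Continuous.aestronglyMeasurable (by fun_prop)
  · exact Continuous.intervalIntegrable (by fun_prop) _ _
  · exact Continuous.aestronglyMeasurable (by fun_prop)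
  · exact Eventually.of_forall fun t ht x hx => hC (x, t) ⟨hx, uIoc_subset_uIcc ht⟩
  · exact intervalIntegrable_const
  · refine Eventually.of_forall fun t _ x _ => ?_
    have h1 : HasDerivAt f (deriv f (x * s t)) (x * s t) :=
      (hf.differentiable one_ne_zero _).hasDerivAt
    have h2 : HasDerivAt (fun x => x * s t) (s t) x := by
      simpa using (hasDerivAt_id x).mul_const (s t)
    exact ((h1.comp x h2).const_mul (w t)).congr_deriv (by ring)

lemma contDiff_integral_mul_comp_mul {w s f : ℝ → ℝ} (hw : Continuous w) (hs : Continuous s)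
    (hf : ContDiff ℝ (⊤ : ℕ∞) f) (a b : ℝ) :
    ContDiff ℝ (⊤ : ℕ∞) (fun r => ∫ θ in a..b, w θ * f (r * s θ)) := by
  rw [contDiff_infty]
  intro n
  induction n generalizing w f with
  | zero =>
    rw [Nat.cast_zero, contDiff_zero, continuous_iff_continuousAt]
    exact fun r =>
      (hasDerivAt_integral_mul_comp_mul hw hs (hf.of_le (mod_cast le_top)) a b r).continuousAt
  | succ n ih =>
    have hd := hasDerivAt_integral_mul_comp_mul hw hs (hf.of_le (mod_cast le_top)) a b
    rw [Nat.cast_add, Nat.cast_one, contDiff_succ_iff_deriv]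
    refine ⟨fun r => (hd r).differentiableAt, by simp, ?_⟩
    rw [funext fun r => (hd r).deriv]
    exact ih (hw.mul hs) (contDiff_infty_iff_deriv.1 hf).2

/-- Hadamard's lemma: a smooth function vanishing at `0` is divisible by the identity. -/
lemma exists_contDiff_eq_mul {f : ℝ → ℝ} (hf : ContDiff ℝ (⊤ : ℕ∞) f) (h0 : f 0 = 0) :
    ∃ g : ℝ → ℝ, ContDiff ℝ (⊤ : ℕ∞) g ∧ ∀ t, f t = t * g t := by
  have hf' := contDiff_infty_iff_deriv.1 hf
  refine ⟨_, contDiff_integral_mul_comp_mul (w := fun _ => 1) (s := fun s => s)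
    continuous_const continuous_id hf'.2 0 1, fun t => ?_⟩
  simp only [one_mul]
  rw [mul_integral_comp_mul_left, mul_zero, mul_one,
    integral_deriv_eq_sub (fun x _ => hf'.1 x) (hf'.2.continuous.intervalIntegrable _ _), h0,
    sub_zero]

lemma pos_of_deriv_ne_zero {V : ℝ → ℝ} (hV : Continuous V) (hV0 : V 0 = 0)
    (hVcrit : ∀ t : ℝ, deriv V t = 0 ↔ t = 0)
    (hVtop : Tendsto V atTop atTop) {t : ℝ} (ht : 0 < t) : 0 < V t := by
  have hne : ∀ s, 0 < s → V s ≠ 0 := by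
    intro s hs h
    obtain ⟨c, hc, hc'⟩ := exists_deriv_eq_zero hs hV.continuousOn (hV0.trans h.symm)
    exact hc.1.ne' ((hVcrit c).1 hc')
  by_contra hneg
  obtain ⟨u, hu, htu⟩ := ((hVtop.eventually_gt_atTop 0).and (eventually_ge_atTop t)).exists
  obtain ⟨c, hc, hc'⟩ := intermediate_value_Icc htu hV.continuousOn ⟨not_lt.1 hneg, hu.le⟩
  exact hne c (ht.trans_le hc.1) hc'

/-- A single well potential is the square of a diffeomorphism of the line. -/
lemma exists_contDiff_sq_eq {V : ℝ → ℝ}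
    (hV : ContDiff ℝ (⊤ : ℕ∞) V)
    (hV0 : V 0 = 0)
    (hVcrit : ∀ t : ℝ, deriv V t = 0 ↔ t = 0)
    (hV'' : deriv (deriv V) 0 = 2)
    (hVtop : Tendsto V atTop atTop)
    (hVbot : Tendsto V atBot atTop) :
    ∃ X : ℝ → ℝ, ContDiff ℝ (⊤ : ℕ∞) X ∧ (∀ t, 0 < deriv X t) ∧ (∀ t, V t = X t ^ 2) ∧
      X 0 = 0 ∧ Tendsto X atTop atTop ∧ Tendsto X atBot atBot := by
  obtain ⟨g, hg, hVg⟩ := exists_contDiff_eq_mul hV hV0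
  have hdV : deriv V = fun t => g t + t * deriv g t := by
    have hdg := (contDiff_infty_iff_deriv.1 hg).1
    ext t
    rw [funext hVg]
    exact (((hasDerivAt_id t).mul (hdg t).hasDerivAt).congr_deriv (by simp)).deriv
  have hg0 : g 0 = 0 := by
    have := congrFun hdV 0
    rw [(hVcrit 0).2 rfl] at this
    simpa using this.symm
  obtain ⟨W, hW, hgW⟩ := exists_contDiff_eq_mul hg hg0
  have hVW : ∀ t, V t = t ^ 2 * W t := fun t => by rw [hVg, hgW]; ring
  have hW0 : W 0 = 1 := by
    have hdg' := contDiff_infty_iff_deriv.1 hg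
    have h1 : deriv g 0 = W 0 := by
      have hdW := (contDiff_infty_iff_deriv.1 hW).1
      rw [funext hgW]
      exact (((hasDerivAt_id 0).mul (hdW 0).hasDerivAt).congr_deriv (by simp)).deriv
    have h2 : deriv (deriv V) 0 = 2 * deriv g 0 := by
      rw [hdV]
      have h3 := (hasDerivAt_id (0 : ℝ)).mul
        ((contDiff_infty_iff_deriv.1 hdg'.2).1 0).hasDerivAt
      refine (((hdg'.1 0).hasDerivAt.add h3).congr_deriv ?_).deriv
      simp; ring
    linarith
  have hVpos : ∀ t, t ≠ 0 → 0 < V t := by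
    intro t ht
    rcases lt_or_gt_of_ne ht with h | h
    · have := pos_of_deriv_ne_zero (V := fun t => V (-t)) (hV.continuous.comp continuous_neg)
        (by simpa using hV0) (fun t => by simp [deriv_comp_neg, hVcrit])
        (hVbot.comp tendsto_neg_atTop_atBot) (neg_pos.2 h)
      simpa using this
    · exact pos_of_deriv_ne_zero hV.continuous hV0 hVcrit hVtop h
  have hWpos : ∀ t, 0 < W t := by
    intro t
    rcases eq_or_ne t 0 with rfl | ht
    · simp [hW0]
    · have := hVpos t ht
      rw [hVW] at this
      exact pos_of_mul_pos_right this (sq_nonneg t)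
  have hS : ContDiff ℝ (⊤ : ℕ∞) fun t => √(W t) := hW.sqrt fun t => (hWpos t).ne'
  have hX : ContDiff ℝ (⊤ : ℕ∞) fun t => t * √(W t) := contDiff_id.mul hS
  have hsq : ∀ t, V t = (t * √(W t)) ^ 2 := fun t => by
    rw [mul_pow, Real.sq_sqrt (hWpos t).le, hVW]
  have hX' := contDiff_infty_iff_deriv.1 hX
  have hX0 : deriv (fun t => t * √(W t)) 0 = 1 := by
    have h := (hasDerivAt_id (0 : ℝ)).mul ((contDiff_infty_iff_deriv.1 hS).1 0).hasDerivAt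
    exact (h.congr_deriv (by simp [hW0])).deriv
  have hXne : ∀ t, deriv (fun t => t * √(W t)) t ≠ 0 := by
    intro t ht
    rcases eq_or_ne t 0 with rfl | h0
    · simp [hX0] at ht
    · refine h0 ((hVcrit t).1 ?_)
      rw [funext hsq]
      exact (((hX'.1 t).hasDerivAt.pow 2).congr_deriv (by simp [ht])).deriv
  have hsqrt : ∀ t, √(V t) = |t * √(W t)| := fun t => by rw [hsq, Real.sqrt_sq_eq_abs]
  refine ⟨_, hX, fun t => ?_, hsq, by simp, ?_, ?_⟩
  · by_contra hneg
    obtain ⟨c, hc⟩ := mem_range_of_exists_le_of_exists_ge hX'.2.continuous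
      ⟨t, not_lt.1 hneg⟩ ⟨0, by rw [hX0]; exact zero_le_one⟩
    exact hXne c hc
  · refine (Real.tendsto_sqrt_atTop.comp hVtop).congr' ?_
    filter_upwards [eventually_ge_atTop 0] with t ht
    rw [Function.comp_apply, hsqrt, abs_of_nonneg (by positivity)]
  · refine (tendsto_neg_atTop_atBot.comp (Real.tendsto_sqrt_atTop.comp hVbot)).congr' ?_
    filter_upwards [eventually_le_atBot 0] with t ht
    simp only [Function.comp_apply]
    rw [hsqrt, abs_of_nonpos (mul_nonpos_of_nonpos_of_nonneg ht (Real.sqrt_nonneg _)), neg_neg]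

/-- A proper increasing smooth function with positive derivative has a smooth inverse. -/
lemma exists_contDiff_inverse {X : ℝ → ℝ} (hX : ContDiff ℝ (⊤ : ℕ∞) X)
    (hX' : ∀ t, 0 < deriv X t) (htop : Tendsto X atTop atTop) (hbot : Tendsto X atBot atBot) :
    ∃ Y : ℝ → ℝ, ContDiff ℝ (⊤ : ℕ∞) Y ∧ (∀ x, 0 < deriv Y x) ∧
      (∀ x, X (Y x) = x) ∧ ∀ t, Y (X t) = t := by
  have hmono : StrictMono X := strictMono_of_deriv_pos hX'
  let e := (hmono.orderIsoOfSurjective X (hX.continuous.surjective htop hbot)).toHomeomorph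
  have hXd := (contDiff_infty_iff_deriv.1 hX).1
  have hY : ContDiff ℝ (⊤ : ℕ∞) e.symm :=
    e.contDiff_symm_deriv (fun t => (hX' t).ne') (fun t => (hXd t).hasDerivAt) hX
  have hXY : ∀ x, X (e.symm x) = x := e.apply_symm_apply
  refine ⟨e.symm, hY, fun x => ?_, hXY, e.symm_apply_apply⟩
  have h := (hXd (e.symm x)).hasDerivAt.comp x
    ((contDiff_infty_iff_deriv.1 hY).1 x).hasDerivAt
  have h1 : deriv X (e.symm x) * deriv e.symm x = 1 :=
    h.unique ((hasDerivAt_id x).congr_of_eventuallyEq (Eventually.of_forall hXY))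
  exact pos_of_mul_pos_right (h1 ▸ one_pos) (hX' _).le

open Real in
lemma hasDerivAt_sq_mul_integral_cos_sq {f : ℝ → ℝ} (hf : ContDiff ℝ (⊤ : ℕ∞) f) (r : ℝ) :
    HasDerivAt (fun r => r ^ 2 * ∫ θ in -(π / 2)..π / 2, cos θ ^ 2 * f (r * sin θ))
      (r * ∫ θ in -(π / 2)..π / 2, f (r * sin θ)) r := by
  have hf' := contDiff_infty_iff_deriv.1 hf
  have hfc : Continuous f := hf.continuous
  have hf'c : Continuous (deriv f) := hf'.2.continuous
  have hd := hasDerivAt_integral_mul_comp_mul (w := fun θ => cos θ ^ 2) (s := sin)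
    (by fun_prop) continuous_sin (hf.of_le (mod_cast le_top)) (-(π / 2)) (π / 2) r
  have hprim : ∀ θ ∈ uIcc (-(π / 2)) (π / 2),
      HasDerivAt (fun θ => cos θ * sin θ * f (r * sin θ))
        (2 * (cos θ ^ 2 * f (r * sin θ)) + r * (cos θ ^ 2 * sin θ * deriv f (r * sin θ))
          - f (r * sin θ)) θ := by
    intro θ _
    have h1 : HasDerivAt (fun θ => f (r * sin θ)) (deriv f (r * sin θ) * (r * cos θ)) θ :=
      (hf'.1 _).hasDerivAt.comp θ ((hasDerivAt_sin θ).const_mul r)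
    refine (((hasDerivAt_cos θ).mul (hasDerivAt_sin θ)).mul h1).congr_deriv ?_
    simp only [Pi.mul_apply]
    linear_combination (-f (r * sin θ)) * sin_sq_add_cos_sq θ
  have hzero := integral_eq_sub_of_hasDerivAt hprim (Continuous.intervalIntegrable (by fun_prop) _ _)
  rw [intervalIntegral.integral_sub (Continuous.intervalIntegrable (by fun_prop) _ _)
      (Continuous.intervalIntegrable (by fun_prop) _ _),
    intervalIntegral.integral_add (Continuous.intervalIntegrable (by fun_prop) _ _)
      (Continuous.intervalIntegrable (by fun_prop) _ _),
    intervalIntegral.integral_const_mul, intervalIntegral.integral_const_mul] at hzero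
  simp only [cos_neg, cos_pi_div_two, zero_mul, sub_zero] at hzero
  refine ((hasDerivAt_pow 2 r).mul hd).congr_deriv ?_
  simp only [Nat.cast_ofNat, Nat.add_one_sub_one, pow_one]
  linear_combination r * hzero

open Real in
lemma integral_sqrt_sub_eq {V Y : ℝ → ℝ} (hV : Continuous V) (hY : ContDiff ℝ (⊤ : ℕ∞) Y)
    (hVY : ∀ x, V (Y x) = x ^ 2) {r : ℝ} (hr : 0 ≤ r) :
    ∫ t in Y (-r)..Y r, √(r ^ 2 - V t) =
      r ^ 2 * ∫ θ in -(π / 2)..π / 2, cos θ ^ 2 * deriv Y (r * sin θ) := by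
  have hY' := contDiff_infty_iff_deriv.1 hY
  have hY'c : Continuous (deriv Y) := hY'.2.continuous
  have h := integral_comp_mul_deriv (a := -(π / 2)) (b := π / 2) (f := fun θ => Y (r * sin θ))
    (f' := fun θ => deriv Y (r * sin θ) * (r * cos θ)) (g := fun t => √(r ^ 2 - V t))
    (fun θ _ => (hY'.1 _).hasDerivAt.comp θ ((hasDerivAt_sin θ).const_mul r))
    (by fun_prop) (by fun_prop)
  simp only [sin_neg, sin_pi_div_two, mul_neg, mul_one] at h
  rw [← h, ← intervalIntegral.integral_const_mul]
  refine intervalIntegral.integral_congr fun θ hθ => ?_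
  rw [uIcc_of_le (by linarith [pi_pos])] at hθ
  have hcos : 0 ≤ r * cos θ := mul_nonneg hr (cos_nonneg_of_mem_Icc hθ)
  have hsq : r ^ 2 - (r * sin θ) ^ 2 = (r * cos θ) ^ 2 := by
    linear_combination (-r ^ 2) * sin_sq_add_cos_sq θ
  simp only [Function.comp_apply, hVY]
  rw [hsq, sqrt_sq hcos]
  ring

theorem stmt2 (V : ℝ → ℝ)
    (hV : ContDiff ℝ (⊤ : ℕ∞) V)
    (hV0 : V 0 = 0)
    (hVcrit : ∀ t : ℝ, deriv V t = 0 ↔ t = 0)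
    (hV'' : deriv (deriv V) 0 = 2)
    (hVtop : Tendsto V atTop atTop)
    (hVbot : Tendsto V atBot atTop)
    (tm tp : ℝ → ℝ)
    (htm : ∀ E : ℝ, 0 < E → tm E < 0 ∧ V (tm E) = E)
    (htp : ∀ E : ℝ, 0 < E → 0 < tp E ∧ V (tp E) = E)
    (J : ℝ → ℝ)
    (hJ : ∀ E : ℝ, 0 < E →
      J E = (1 / Real.pi) * ∫ t in tm E..tp E, Real.sqrt (E - V t)) :
    ContDiffOn ℝ (⊤ : ℕ∞) J (Ioi 0) ∧
    (∀ E : ℝ, 0 < E → 0 < deriv J E) ∧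
    BijOn J (Ioi 0) (Ioi 0) := by
  obtain ⟨X, hX, hX', hVX, hX0, hXtop, hXbot⟩ :=
    exists_contDiff_sq_eq hV hV0 hVcrit hV'' hVtop hVbot
  obtain ⟨Y, hY, hY', hXY, hYX⟩ := exists_contDiff_inverse hX hX' hXtop hXbot
  have hXmono : StrictMono X := strictMono_of_deriv_pos hX'
  have hYmono : StrictMono Y := strictMono_of_deriv_pos hY'
  have hVY : ∀ x, V (Y x) = x ^ 2 := fun x => by rw [hVX, hXY]
  have hdY : ContDiff ℝ (⊤ : ℕ∞) (deriv Y) := (contDiff_infty_iff_deriv.1 hY).2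
  have hdYc : Continuous (deriv Y) := hdY.continuous
  have hYtp : ∀ E, 0 < E → tp E = Y √E := by
    intro E hE
    have h1 : 0 < X (tp E) := hX0 ▸ hXmono (htp E hE).1
    conv_rhs => rw [← (htp E hE).2]
    rw [hVX, Real.sqrt_sq h1.le, hYX]
  have hYtm : ∀ E, 0 < E → tm E = Y (-√E) := by
    intro E hE
    have h1 : X (tm E) < 0 := hX0 ▸ hXmono (htm E hE).1
    conv_rhs => rw [← (htm E hE).2]
    rw [hVX, Real.sqrt_sq_eq_abs, abs_of_neg h1, neg_neg, hYX]
  set K : ℝ → ℝ := fun r => 1 / Real.pi *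
    (r ^ 2 * ∫ θ in -(Real.pi / 2)..Real.pi / 2, Real.cos θ ^ 2 * deriv Y (r * Real.sin θ)) with hK
  have hKsm : ContDiff ℝ (⊤ : ℕ∞) K :=
    contDiff_const.mul ((contDiff_id.pow 2).mul (contDiff_integral_mul_comp_mul
      (Real.continuous_cos.pow 2) Real.continuous_sin hdY _ _))
  have hJK : ∀ E, 0 < E → J E = K √E := by
    intro E hE
    rw [hJ E hE, hYtm E hE, hYtp E hE, hK]
    simp only
    rw [← integral_sqrt_sub_eq hV.continuous hY hVY (Real.sqrt_nonneg E), Real.sq_sqrt hE.le]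
  have hderiv : ∀ E, 0 < E → 0 < deriv J E := by
    intro E hE
    have hr : 0 < √E := Real.sqrt_pos.2 hE
    have hI : 0 < ∫ θ in -(Real.pi / 2)..Real.pi / 2, deriv Y (√E * Real.sin θ) :=
      intervalIntegral_pos_of_pos (Continuous.intervalIntegrable (by fun_prop) _ _)
        (fun _ => hY' _) (by linarith [Real.pi_pos])
    have h := (((hasDerivAt_sq_mul_integral_cos_sq hdY √E).const_mul (1 / Real.pi)).comp E
      (Real.hasDerivAt_sqrt hE.ne')).congr_of_eventuallyEq
      (f₁ := J) (by filter_upwards [lt_mem_nhds hE] with x hx using hJK x hx)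
    rw [h.deriv]
    have := Real.pi_pos
    positivity
  have hJsm : ContDiffOn ℝ (⊤ : ℕ∞) J (Ioi 0) :=
    (hKsm.comp_contDiffOn (contDiffOn_id.sqrt fun E hE => (ne_of_gt hE))).congr
      fun E hE => hJK E hE
  have hmono : StrictMonoOn J (Ioi 0) :=
    strictMonoOn_of_deriv_pos (convex_Ioi 0) hJsm.continuousOn fun E hE =>
      hderiv E (by rwa [interior_Ioi] at hE)
  have hJpos : ∀ E, 0 < E → 0 < J E := by
    intro E hE
    have hlt : tm E < tp E := (htm E hE).1.trans (htp E hE).1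
    have hVc := hV.continuous
    rw [hJ E hE]
    refine mul_pos (by have := Real.pi_pos; positivity) ?_
    refine intervalIntegral_pos_of_pos_on (Continuous.intervalIntegrable (by fun_prop) _ _)
      (fun t ht => Real.sqrt_pos.2 (sub_pos.2 ?_)) hlt
    have h1 : -√E < X t := by
      have := hXmono ht.1
      rwa [hYtm E hE, hXY] at this
    have h2 : X t < √E := by
      have := hXmono ht.2
      rwa [hYtp E hE, hXY] at this
    rw [hVX, ← Real.sq_sqrt hE.le]
    exact sq_lt_sq' h1 h2
  have hJbig : ∀ E, 1 < E → 1 / Real.pi * ((Y 1 - Y (-1)) * √(E - 1)) ≤ J E := by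
    intro E hE
    have hE0 : 0 < E := one_pos.trans hE
    have hr : 1 ≤ √E := Real.one_le_sqrt.2 hE.le
    have hVc := hV.continuous
    have h1 : Y (-1) ≤ Y 1 := hYmono.monotone (by norm_num)
    rw [hJ E hE0, hYtm E hE0, hYtp E hE0]
    refine mul_le_mul_of_nonneg_left ?_ (by have := Real.pi_pos; positivity)
    calc (Y 1 - Y (-1)) * √(E - 1) = ∫ _ in Y (-1)..Y 1, √(E - 1) := by simp
      _ ≤ ∫ t in Y (-1)..Y 1, √(E - V t) := by
        refine integral_mono_on h1 intervalIntegrable_const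
          (Continuous.intervalIntegrable (by fun_prop) _ _) fun t ht => ?_
        have h2 := hXmono.monotone ht.1
        have h3 := hXmono.monotone ht.2
        rw [hXY] at h2 h3
        refine Real.sqrt_le_sqrt (sub_le_sub_left ?_ _)
        rw [hVX]
        exact (sq_le_one_iff_abs_le_one _).2 (abs_le.2 ⟨h2, h3⟩)
      _ ≤ ∫ t in Y (-√E)..Y √E, √(E - V t) :=
        integral_mono_interval (hYmono.monotone (neg_le_neg hr)) h1 (hYmono.monotone hr)
          (Eventually.of_forall fun _ => Real.sqrt_nonneg _)
          (Continuous.intervalIntegrable (by fun_prop) _ _)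
  have hJtop : Tendsto J atTop atTop := by
    have hc : 0 < Y 1 - Y (-1) := sub_pos.2 (hYmono (by norm_num))
    refine tendsto_atTop_mono' _ ((eventually_gt_atTop 1).mono hJbig) ?_
    exact Tendsto.const_mul_atTop (by have := Real.pi_pos; positivity)
      (Tendsto.const_mul_atTop hc
        (Real.tendsto_sqrt_atTop.comp (tendsto_atTop_add_const_right _ (-1) tendsto_id)))
  have hJzero : Tendsto J (nhdsWithin 0 (Ioi 0)) (nhds 0) := by
    have h : Tendsto (fun E => K √E) (nhds 0) (nhds 0) := by
      have hc : Continuous fun E => K √E := hKsm.continuous.comp Real.continuous_sqrt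
      simpa [hK] using hc.tendsto 0
    exact (h.mono_left nhdsWithin_le_nhds).congr' (by
      filter_upwards [self_mem_nhdsWithin] with E hE using (hJK E hE).symm)
  refine ⟨hJsm, hderiv, fun E hE => hJpos E hE, hmono.injOn, fun y hy => ?_⟩
  obtain ⟨a, hay, ha⟩ := ((hJzero.eventually_lt_const (mem_Ioi.1 hy)).and
    self_mem_nhdsWithin).exists
  obtain ⟨b, hyb, hab⟩ := ((hJtop.eventually_gt_atTop y).and (eventually_ge_atTop a)).exists
  obtain ⟨c, hc, hcy⟩ := intermediate_value_Icc hab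
    (hJsm.continuousOn.mono fun x hx => lt_of_lt_of_le ha hx.1) ⟨hay.le, hyb.le⟩
  exact ⟨c, lt_of_lt_of_le ha hc.1, hcy⟩
end
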